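/- Let X be a set with an adjacency relation, Y a measurable space, and A a mechanism assigning to each x ∈ X a probability measure A(x) on Y that satisfies (ε, δ)-DP for ε ≥ 0, δ ∈ [0,1]. Let d ≥ 1, let f_enc : Y → (density matrices on ℂ^d) be measurable, let {E_k}_{k=1}^K be a POVM on ℂ^d with φ := min_k (Tr(E_k)/d) satisfying e^ε · φ ≤ 1, and let η ∈ [0,1]. Define the composed mechanism M(x)(k) = ∫_Y Tr[E_k ((1−η) f_enc(y) + η I/d)] dA(x)(y). Set ε' = log(1 + (1−η)(e^ε − 1)) and δ' = (1−η)·(1 − e^{ε'−ε}(1−δ) − (e^ε − e^{ε'})·φ). Then for all adjacent x, x': Σ_{k=1}^K max(0, M(x)(k) − e^{ε'} M(x')(k)) ≤ δ', i.e. the composed mechanism satisfies (ε', δ')-DP. -/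

import Mathlib

open MeasureTheory Matrix
open scoped ComplexOrder

open scoped MatrixOrder Matrix.Norms.L2Operator in
theorem Matrix.PosSemidef.re_trace_mul_nonneg {n : Type*} [Fintype n] [DecidableEq n]
    {P Q : Matrix n n ℂ} (hP : P.PosSemidef) (hQ : Q.PosSemidef) : 0 ≤ (P * Q).trace.re := by
  obtain ⟨B, rfl⟩ := CStarAlgebra.nonneg_iff_eq_star_mul_self.mp hP.nonneg
  rw [Matrix.star_eq_conjTranspose, Matrix.trace_mul_cycle]
  have h := (hQ.mul_mul_conjTranspose_same B).trace_nonneg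
  rw [Matrix.mul_assoc, Matrix.trace_mul_comm] at h
  exact (Complex.le_def.mp h).1

/-- A bound on events between finite measures extends to `[0, 1]`-valued tests. -/
theorem MeasureTheory.integral_le_mul_integral_add_of_measure_le {Y : Type*} [MeasurableSpace Y]
    {μ ν : Measure Y} [IsFiniteMeasure μ] [IsFiniteMeasure ν] {α δ : ℝ}
    (h : ∀ S, MeasurableSet S → μ.real S ≤ α * ν.real S + δ)
    {g : Y → ℝ} (hg : Measurable g) (hg0 : ∀ y, 0 ≤ g y) (hg1 : ∀ y, g y ≤ 1) :
    ∫ y, g y ∂μ ≤ α * ∫ y, g y ∂ν + δ := by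
  have hint : ∀ (m : Measure Y) [IsFiniteMeasure m], Integrable g m := fun m _ =>
    Integrable.of_bound hg.aestronglyMeasurable 1 (.of_forall fun y => by
      rw [Real.norm_of_nonneg (hg0 y)]; exact hg1 y)
  have hanti : ∀ (m : Measure Y) [IsFiniteMeasure m],
      IntegrableOn (fun t => m.real {y | t ≤ g y}) (Set.Ioc 0 1) := fun m _ => by
    have ha : Antitone fun t => m.real {y | t ≤ g y} := fun s t hst =>
      measureReal_mono fun y (hy : t ≤ g y) => hst.trans hy
    exact ((ha.antitoneOn _).integrableOn_isCompact isCompact_Icc).mono_set Set.Ioc_subset_Icc_self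
  rw [(hint μ).integral_eq_integral_Ioc_meas_le (.of_forall hg0) (.of_forall hg1),
    (hint ν).integral_eq_integral_Ioc_meas_le (.of_forall hg0) (.of_forall hg1)]
  calc _ ≤ ∫ t in Set.Ioc (0 : ℝ) 1, (α * ν.real {y | t ≤ g y} + δ) :=
        setIntegral_mono (hanti μ) (((hanti ν).const_mul α).add (integrable_const δ))
          fun t => h _ (measurableSet_le measurable_const hg)
    _ = _ := by
        rw [integral_add ((hanti ν).const_mul α) (integrable_const δ), integral_const_mul]
        simp

theorem Finset.sum_max_zero_eq_sum_filter {ι : Type*} [Fintype ι] (f : ι → ℝ) :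
    ∑ k, max 0 (f k) = ∑ k with 0 < f k, f k := by
  rw [Finset.sum_filter]
  refine Finset.sum_congr rfl fun k _ => ?_
  split_ifs with h
  · exact max_eq_right h.le
  · exact max_eq_left (not_lt.mp h)

/-- Simultaneous amplification of the privacy loss and the failure
probability under depolarizing quantum post-processing. -/
theorem depolarizing_privacy_loss_amplification
    {X Y : Type*} [MeasurableSpace Y]
    (Adj : X → X → Prop)
    (A : X → Measure Y)
    (hprob : ∀ x, IsProbabilityMeasure (A x))
    (ε δ : ℝ) (hε : 0 ≤ ε) (hδ0 : 0 ≤ δ) (hδ1 : δ ≤ 1)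
    (hDP : ∀ x x', Adj x x' → ∀ S : Set Y, MeasurableSet S →
      ((A x) S).toReal ≤ Real.exp ε * ((A x') S).toReal + δ)
    (d : ℕ) (hd : 1 ≤ d)
    (f_enc : Y → Matrix (Fin d) (Fin d) ℂ)
    (hmeas : ∀ i j, Measurable fun y => f_enc y i j)
    (hdens : ∀ y, (f_enc y).PosSemidef ∧ (f_enc y).trace = 1)
    (K : ℕ) (hK : 0 < K) (E : Fin K → Matrix (Fin d) (Fin d) ℂ)
    (hE : ∀ k, (E k).PosSemidef) (hEsum : ∑ k, E k = 1)
    (φ : ℝ) (hφ : φ = ⨅ k : Fin K, ((E k).trace.re / d))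
    (hφ1 : Real.exp ε * φ ≤ 1)
    (η : ℝ) (hη0 : 0 ≤ η) (hη1 : η ≤ 1)
    (M : X → Fin K → ℝ)
    (hM : ∀ x k, M x k = ∫ y,
      ((E k * (((1 - η : ℝ) : ℂ) • f_enc y +
        ((η / d : ℝ) : ℂ) • (1 : Matrix (Fin d) (Fin d) ℂ))).trace).re ∂(A x))
    (ε' δ' : ℝ)
    (hε' : ε' = Real.log (1 + (1 - η) * (Real.exp ε - 1)))
    (hδ' : δ' = (1 - η) *
      (1 - Real.exp (ε' - ε) * (1 - δ) - (Real.exp ε - Real.exp ε') * φ)) :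
    ∀ x x', Adj x x' →
      ∑ k, max 0 (M x k - Real.exp ε' * M x' k) ≤ δ' := by
  intro x x' hadj
  have hdpos : (0 : ℝ) < d := by exact_mod_cast hd
  set r : Fin K → Y → ℝ := fun k y => (E k * f_enc y).trace.re with hr
  set τ : Fin K → ℝ := fun k => (E k).trace.re / d with hτ
  have hr0 : ∀ k y, 0 ≤ r k y := fun k y => (hE k).re_trace_mul_nonneg (hdens y).1
  have hr1 : ∀ y, ∑ k, r k y = 1 := fun y => by
    simp only [hr]
    rw [← Complex.re_sum, ← Matrix.trace_sum, ← Finset.sum_mul, hEsum, one_mul, (hdens y).2,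
      Complex.one_re]
  have hrS : ∀ (S : Finset (Fin K)) y, ∑ k ∈ S, r k y ≤ 1 := fun S y =>
    (Finset.sum_le_univ_sum_of_nonneg fun k => hr0 k y).trans (hr1 y).le
  have hrm : ∀ k, Measurable (r k) := fun k => by
    simp only [hr, Matrix.trace, Matrix.diag_apply, Matrix.mul_apply]
    fun_prop
  have hri : ∀ z k, Integrable (r k) (A z) := fun z k =>
    have := hprob z
    Integrable.of_bound (hrm k).aestronglyMeasurable 1 (.of_forall fun y => by
      rw [Real.norm_of_nonneg (hr0 k y)]
      simpa using hrS {k} y)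
  have hτ0 : ∀ k, 0 ≤ τ k := fun k =>
    div_nonneg (Complex.le_def.mp (hE k).trace_nonneg).1 hdpos.le
  have hφτ : ∀ k, φ ≤ τ k := fun k => hφ ▸ ciInf_le (Set.finite_range _).bddBelow k
  have hMk : ∀ z k, M z k = (1 - η) * ∫ y, r k y ∂(A z) + η * τ k := fun z k => by
    have := hprob z
    have hpt : ∀ y, ((E k * (((1 - η : ℝ) : ℂ) • f_enc y +
        ((η / d : ℝ) : ℂ) • (1 : Matrix (Fin d) (Fin d) ℂ))).trace).re
        = (1 - η) * r k y + η * τ k := fun y => by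
      rw [Matrix.mul_add, Matrix.mul_smul, Matrix.mul_smul, Matrix.mul_one, Matrix.trace_add,
        Matrix.trace_smul, Matrix.trace_smul, Complex.add_re, smul_eq_mul, smul_eq_mul,
        Complex.re_ofReal_mul, Complex.re_ofReal_mul]
      simp only [hr, hτ]
      ring
    rw [hM, integral_congr_ae (.of_forall hpt),
      integral_add ((hri z k).const_mul _) (integrable_const _), integral_const_mul]
    simp
  have hα : 1 ≤ Real.exp ε := Real.one_le_exp hε
  have hexp : Real.exp ε' = 1 + (1 - η) * (Real.exp ε - 1) := by
    rw [hε', Real.exp_log (by nlinarith)]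
  rw [Real.exp_sub] at hδ'
  set α := Real.exp ε
  set β := Real.exp ε'
  have hβ1 : 1 ≤ β := by nlinarith
  have hβα : β ≤ α := by nlinarith
  have hα0 : 0 < α := by linarith
  have hterm : ∀ k, M x k - β * M x' k = (1 - η) *
      (∫ y, r k y ∂(A x) - β * ∫ y, r k y ∂(A x') - (α - β) * τ k) := fun k => by
    rw [hMk, hMk, hexp]
    ring
  rw [Finset.sum_max_zero_eq_sum_filter]
  generalize (Finset.univ.filter fun k => 0 < M x k - β * M x' k) = S
  simp only [hterm]
  rw [← Finset.mul_sum, hδ']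
  refine mul_le_mul_of_nonneg_left ?_ (by linarith)
  rcases S.eq_empty_or_nonempty with rfl | ⟨k₀, hk₀⟩
  · have hφα : φ ≤ 1 / α := by rw [le_div_iff₀ hα0]; linarith
    have h1 := mul_le_mul_of_nonneg_left hφα (sub_nonneg.mpr hβα)
    have h2 : (α - β) * (1 / α) = 1 - β / α := by field_simp
    have h3 : 0 ≤ β / α * δ := by positivity
    rw [Finset.sum_empty]
    linarith
  · have := hprob x
    have := hprob x'
    have hτS : φ ≤ ∑ k ∈ S, τ k :=
      (hφτ k₀).trans (Finset.single_le_sum (fun k _ => hτ0 k) hk₀)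
    have hDPS := integral_le_mul_integral_add_of_measure_le (hDP x x' hadj)
      (Finset.measurable_fun_sum S fun k _ => hrm k)
      (fun y => Finset.sum_nonneg fun k _ => hr0 k y) (hrS S)
    have hP1 : ∫ y, ∑ k ∈ S, r k y ∂(A x) ≤ 1 := by
      simpa using integral_mono (integrable_finsetSum S fun k _ => hri x k)
        (integrable_const (1 : ℝ)) (hrS S)
    rw [integral_finsetSum S fun k _ => hri x k] at hDPS hP1
    rw [integral_finsetSum S fun k _ => hri x' k] at hDPS
    rw [Finset.sum_sub_distrib, Finset.sum_sub_distrib, ← Finset.mul_sum, ← Finset.mul_sum]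
    set p := ∑ k ∈ S, ∫ y, r k y ∂(A x)
    set q := ∑ k ∈ S, ∫ y, r k y ∂(A x')
    have h1 := mul_le_mul_of_nonneg_left hτS (sub_nonneg.mpr hβα)
    have hβdiv : β / α ≤ 1 := (div_le_one hα0).mpr hβα
    have h2 := mul_le_mul_of_nonneg_left hDPS (by positivity : 0 ≤ β / α)
    have h3 : β / α * (α * q + δ) = β * q + β / α * δ := by field_simp
    have h4 := mul_le_mul_of_nonneg_left hP1 (sub_nonneg.mpr hβdiv)
    linarith
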